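/- arXiv:1804.01493 — 2 statements merged into one kernel-verified Lean document; each statement's English description precedes it below -/
import Mathlib

section
/- Suppose x >= 0. Then condition (C1) holds if and only if condition (CA1) holds. -/
/-- A finite list of real numbers "has the same sign" if either all entries are
nonnegative or all entries are nonpositive. -/
def SameSign (l : List ℝ) : Prop := (∀ t ∈ l, 0 ≤ t) ∨ (∀ t ∈ l, t ≤ 0)

/-- The determinant of the symmetric `3 × 3` matrix that holds the coefficients of the Bezoutian
`(b(z) a(w) - a(z) b(w)) / (z - w)` of two cubic polynomials. -/
def bezoutDet (a0 a1 a2 a3 b0 b1 b2 b3 : ℝ) : ℝ :=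
  (b1 * a0 - a1 * b0) * (b3 * a0 - a3 * b0 + (b2 * a1 - a2 * b1)) * (b3 * a2 - a3 * b2)
    + 2 * (b2 * a0 - a2 * b0) * (b3 * a1 - a3 * b1) * (b3 * a0 - a3 * b0)
    - (b3 * a0 - a3 * b0) ^ 2 * (b3 * a0 - a3 * b0 + (b2 * a1 - a2 * b1))
    - (b2 * a0 - a2 * b0) ^ 2 * (b3 * a2 - a3 * b2)
    - (b3 * a1 - a3 * b1) ^ 2 * (b1 * a0 - a1 * b0)

/-- The resultant of a quadratic polynomial `c` and a cubic polynomial `b`. -/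
def quadCubicResultant (c0 c1 c2 b0 b1 b2 b3 : ℝ) : ℝ :=
  b3 ^ 2 * c0 ^ 3 - b3 * b2 * c0 ^ 2 * c1 + b3 * b1 * (c0 * c1 ^ 2 - 2 * c0 ^ 2 * c2)
    + b3 * b0 * (3 * c0 * c1 * c2 - c1 ^ 3) + b2 ^ 2 * c0 ^ 2 * c2 - b2 * b1 * c0 * c1 * c2
    + b2 * b0 * (c1 ^ 2 * c2 - 2 * c0 * c2 ^ 2) + b1 ^ 2 * c0 * c2 ^ 2 - b1 * b0 * c1 * c2 ^ 2
    + b0 ^ 2 * c2 ^ 3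

theorem det_eq_bezoutDet {a0 a1 a2 a3 b0 b1 b2 b3 : ℝ} {a b : ℝ → ℝ}
    (ha : ∀ s, a s = a3 * s ^ 3 + a2 * s ^ 2 + a1 * s + a0)
    (hb : ∀ s, b s = b3 * s ^ 3 + b2 * s ^ 2 + b1 * s + b0)
    {B : Matrix (Fin 3) (Fin 3) ℝ} (hBsymm : B.IsSymm)
    (hB : ∀ z w : ℝ, z ≠ w →
        b z * a w - a z * b w
          = (z - w) * ∑ i : Fin 3, ∑ j : Fin 3, B i j * z ^ (i : ℕ) * w ^ (j : ℕ)) :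
    B.det = bezoutDet a0 a1 a2 a3 b0 b1 b2 b3 := by
  have h10 : B 1 0 = B 0 1 := hBsymm.apply 0 1
  have h20 : B 2 0 = B 0 2 := hBsymm.apply 0 2
  have h21 : B 2 1 = B 1 2 := hBsymm.apply 1 2
  simp only [Fin.sum_univ_three, ha, hb, h10, h20, h21, Fin.val_zero, Fin.val_one,
    Fin.val_two] at hB
  have e1 := hB 0 1 (by norm_num)
  have e2 := hB 0 (-1) (by norm_num)
  have e3 := hB 0 2 (by norm_num)
  have e4 := hB 1 (-1) (by norm_num)
  have e5 := hB 1 2 (by norm_num)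
  have e6 := hB (-1) 2 (by norm_num)
  ring_nf at e1 e2 e3 e4 e5 e6
  have h00 : B 0 0 = b1 * a0 - a1 * b0 := by linarith
  have h01 : B 0 1 = b2 * a0 - a2 * b0 := by linarith
  have h02 : B 0 2 = b3 * a0 - a3 * b0 := by linarith
  have h11 : B 1 1 = b3 * a0 - a3 * b0 + (b2 * a1 - a2 * b1) := by linarith
  have h12 : B 1 2 = b3 * a1 - a3 * b1 := by linarith
  have h22 : B 2 2 = b3 * a2 - a3 * b2 := by linarith
  rw [Matrix.det_fin_three, h10, h20, h21, h00, h01, h02, h11, h12, h22, bezoutDet]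
  ring

theorem bezoutDet_smul_add_smul (k m a0 a1 a2 a3 b0 b1 b2 b3 : ℝ) :
    bezoutDet (k * a0 + m * b0) (k * a1 + m * b1) (k * a2 + m * b2) (k * a3 + m * b3) b0 b1 b2 b3
      = k ^ 3 * bezoutDet a0 a1 a2 a3 b0 b1 b2 b3 := by
  unfold bezoutDet
  ring

theorem bezoutDet_mul_linear (x c0 c1 c2 b0 b1 b2 b3 : ℝ) :
    bezoutDet (c0 * x) (c1 * x + c0) (c2 * x + c1) c2 b0 b1 b2 b3
      = (b3 * (-x) ^ 3 + b2 * (-x) ^ 2 + b1 * (-x) + b0)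
        * quadCubicResultant c0 c1 c2 b0 b1 b2 b3 := by
  unfold bezoutDet quadCubicResultant
  ring

theorem quadCubicResultant_mul_linear_add_smul (x m c0 c1 c2 d0 d1 d2 : ℝ) :
    quadCubicResultant c0 c1 c2 (d0 * x + m * c0) (d1 * x + d0 + m * c1) (d2 * x + d1 + m * c2) d2
      = (c2 * x ^ 2 - c1 * x + c0)
        * ((c2 * d0 - c0 * d2) ^ 2 - (c1 * d0 - c0 * d1) * (c2 * d1 - c1 * d2)) := by
  unfold quadCubicResultant
  ring

theorem quadCubicResultant_smul (k c0 c1 c2 b0 b1 b2 b3 : ℝ) :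
    quadCubicResultant c0 c1 c2 (k * b0) (k * b1) (k * b2) (k * b3)
      = k ^ 2 * quadCubicResultant c0 c1 c2 b0 b1 b2 b3 := by
  unfold quadCubicResultant
  ring

/-- Two cubics with a common root `-x` have a singular Bezoutian. -/
theorem bezoutDet_eq_zero_of_common_root {a0 a1 a2 a3 b0 b1 b2 b3 x : ℝ}
    (ha : a3 * (-x) ^ 3 + a2 * (-x) ^ 2 + a1 * (-x) + a0 = 0)
    (hb : b3 * (-x) ^ 3 + b2 * (-x) ^ 2 + b1 * (-x) + b0 = 0) :
    bezoutDet a0 a1 a2 a3 b0 b1 b2 b3 = 0 := by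
  obtain rfl : a0 = a3 * x ^ 3 - a2 * x ^ 2 + a1 * x := by linarith
  obtain rfl : b0 = b3 * x ^ 3 - b2 * x ^ 2 + b1 * x := by linarith
  unfold bezoutDet
  ring

/-- Comparison of the coefficients of `(p2 s² + p1 s + p0) (s + x)` with those of a cubic. -/
theorem coeff_eq_of_mul_linear_eq {p0 p1 p2 x q0 q1 q2 q3 : ℝ}
    (h : ∀ s : ℝ, (p2 * s ^ 2 + p1 * s + p0) * (s + x)
      = q3 * s ^ 3 + q2 * s ^ 2 + q1 * s + q0) :
    q0 = p0 * x ∧ q1 = p1 * x + p0 ∧ q2 = p2 * x + p1 ∧ q3 = p2 := by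
  have e1 := h 0
  have e2 := h 1
  have e3 := h (-1)
  have e4 := h 2
  ring_nf at e1 e2 e3 e4
  refine ⟨?_, ?_, ?_, ?_⟩ <;> linarith

/-- A nonnegative quadratic polynomial has nonnegative coefficients after multiplication by
`s + x`. -/
theorem mul_linear_coeff_nonneg {p0 p1 p2 x : ℝ} (hx : 0 ≤ x) (h0 : 0 ≤ p0) (h1 : 0 ≤ p1)
    (h2 : 0 ≤ p2) : 0 ≤ p0 * x ∧ 0 ≤ p1 * x + p0 ∧ 0 ≤ p2 * x + p1 ∧ 0 ≤ p2 := by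
  refine ⟨?_, ?_, ?_, ?_⟩ <;> positivity

theorem coeffs_nonneg_of_pos {c0 c1 c2 d0 d1 d2 α1 α2 α3 : ℝ}
    (h1 : α1 = c1 * d0 - c0 * d1) (h2 : α2 = c2 * d0 - c0 * d2) (h3 : α3 = c2 * d1 - c1 * d2)
    (hc0 : 0 ≤ c0 * d0) (hl : 0 ≤ d1 * α1 - d0 * α2) (hα2 : 0 ≤ α2 * d0)
    (hd0 : d0 ≠ 0) (hd2 : 0 < d2) (hα1 : 0 < α1) (hdisc : 0 < α2 ^ 2 - α1 * α3) :
    0 ≤ c0 ∧ 0 ≤ c1 ∧ 0 ≤ c2 ∧ 0 < d0 ∧ 0 ≤ d1 ∧ 0 ≤ α2 := by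
  have hplucker : d2 * α1 - d1 * α2 + d0 * α3 = 0 := by subst h1 h2 h3; ring
  have hd1 : 0 ≤ d1 := by
    by_contra! h
    nlinarith [mul_neg_of_neg_of_pos h hα1]
  rcases hd0.lt_or_gt with hneg | hpos
  · exfalso
    have hα2' : α2 ≤ 0 := by
      by_contra! h
      nlinarith [mul_neg_of_pos_of_neg h hneg]
    have k1 : 0 < -d0 * (α2 ^ 2 - α1 * α3) := mul_pos (by linarith) hdisc
    have k2 : 0 ≤ -α2 * (d1 * α1 - d0 * α2) := mul_nonneg (by linarith) hl
    have k3 : 0 < d2 * α1 ^ 2 := by positivity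
    have k4 : -d0 * (α2 ^ 2 - α1 * α3) + -α2 * (d1 * α1 - d0 * α2) + d2 * α1 ^ 2
        = 0 := by
      linear_combination α1 * hplucker
    linarith
  · have hc0' : 0 ≤ c0 := nonneg_of_mul_nonneg_left hc0 hpos
    have hα2' : 0 ≤ α2 := nonneg_of_mul_nonneg_left hα2 hpos
    have hc1 : 0 ≤ c1 := by
      refine nonneg_of_mul_nonneg_left (b := d0) ?_ hpos
      nlinarith [mul_nonneg hc0' hd1]
    have hc2 : 0 ≤ c2 := by
      refine nonneg_of_mul_nonneg_left (b := d0) ?_ hpos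
      nlinarith [mul_nonneg hc0' hd2.le]
    exact ⟨hc0', hc1, hc2, hpos, hd1, hα2'⟩

theorem pos_of_coeffs_nonneg {c0 c1 c2 d0 d1 d2 α1 α2 α3 : ℝ}
    (h1 : α1 = c1 * d0 - c0 * d1) (h2 : α2 = c2 * d0 - c0 * d2) (h3 : α3 = c2 * d1 - c1 * d2)
    (hc0 : 0 ≤ c0) (hc1 : 0 ≤ c1) (hc2 : 0 ≤ c2) (hd0 : 0 ≤ d0) (hd1 : 0 ≤ d1) (hd2 : 0 ≤ d2)
    (hl : 0 ≤ d1 * α1 - d0 * α2) (hα2 : 0 ≤ α2) (hdisc : 0 < α2 ^ 2 - α1 * α3) :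
    0 < d0 ∧ 0 < d2 ∧ 0 < α1 := by
  have hplucker : d2 * α1 - d1 * α2 + d0 * α3 = 0 := by subst h1 h2 h3; ring
  have hd0' : 0 < d0 := by
    refine hd0.lt_of_ne' fun h ↦ ?_
    subst h
    have hα2' : α2 = 0 := le_antisymm (by nlinarith [mul_nonneg hc0 hd2]) hα2
    have hα1 : α1 ≤ 0 := by nlinarith [mul_nonneg hc0 hd1]
    have hz : d1 * α1 = 0 :=
      le_antisymm (mul_nonpos_of_nonneg_of_nonpos hd1 hα1) (by linarith)
    rcases mul_eq_zero.1 hz with h | h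
    · subst h
      simp [h1, hα2'] at hdisc
    · simp [h, hα2'] at hdisc
  have hd2' : 0 < d2 := by
    refine hd2.lt_of_ne' fun h ↦ ?_
    subst h
    have hα3 : α1 * α3 = c2 * (d1 * α1) := by rw [h3]; ring
    have hα2' : α2 ^ 2 = c2 * (d0 * α2) := by rw [pow_two]; nth_rw 1 [h2]; ring
    nlinarith [mul_nonneg hc2 hl]
  refine ⟨hd0', hd2', ?_⟩
  by_contra! hα1
  have hz : d0 * α2 ≤ 0 := by nlinarith [mul_nonneg hd1 (neg_nonneg.2 hα1)]
  have hα2' : α2 = 0 := le_antisymm (nonpos_of_mul_nonpos_right hz hd0') hα2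
  subst hα2'
  have hα3 : 0 ≤ -α1 * α3 := by nlinarith
  have key : d0 * (-α1 * α3) = d2 * α1 ^ 2 := by linear_combination (-α1) * hplucker
  have hd1α1 : d1 * α1 = 0 :=
    le_antisymm (mul_nonpos_of_nonneg_of_nonpos hd1 hα1) (by linarith)
  rcases mul_eq_zero.1 hd1α1 with h | h
  · subst h
    have : α1 = 0 := le_antisymm hα1 (by rw [h1]; nlinarith [mul_nonneg hc1 hd0])
    simp [this] at hdisc
  · simp [h] at hdisc

theorem bezoutDet_eq_zero_of_proportional {a0 a1 a2 a3 b0 b1 b2 b3 k m : ℝ} (hk : k ≠ 0)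
    (h0 : a0 * k = b0 * m) (h1 : a1 * k = b1 * m) (h2 : a2 * k = b2 * m) (h3 : a3 * k = b3 * m) :
    bezoutDet a0 a1 a2 a3 b0 b1 b2 b3 = 0 := by
  have h := bezoutDet_smul_add_smul k (-m) a0 a1 a2 a3 b0 b1 b2 b3
  have e0 : k * a0 + -m * b0 = 0 := by linarith
  have e1 : k * a1 + -m * b1 = 0 := by linarith
  have e2 : k * a2 + -m * b2 = 0 := by linarith
  have e3 : k * a3 + -m * b3 = 0 := by linarith
  rw [e0, e1, e2, e3] at h
  have hz : bezoutDet 0 0 0 0 b0 b1 b2 b3 = 0 := by simp [bezoutDet]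
  rw [hz] at h
  simpa [hk] using h.symm

theorem nonpos_of_mul_eq_neg {p q t : ℝ} (ht : t ≠ 0) (hp : 0 ≤ p * t) (h : p = -(q * t)) :
    q ≤ 0 := by
  have : 0 < t ^ 2 := by positivity
  by_contra! hq
  subst h
  nlinarith [mul_pos hq this]

theorem eq_zero_of_eq_neg_sq_mul {p q t : ℝ} (ht : t ≠ 0) (hpq : 0 ≤ q * p)
    (h : p = -(t ^ 2 * q)) : p = 0 ∧ q = 0 := by
  have : 0 < t ^ 2 := by positivity
  subst h
  have hq : q = 0 := by
    by_contra hq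
    have : 0 < t ^ 2 * q ^ 2 := by positivity
    nlinarith
  simp [hq]

/-- The Bezoutian of `a` and `b` in terms of the reduced polynomials `c` and `d`. -/
theorem bezoutDet_mul_eq {a0 a1 a2 a3 b0 b1 b2 b3 x atil bt c0 c1 c2 ct d0 d1 d2 : ℝ}
    (hbt : bt = b3 * (-x) ^ 3 + b2 * (-x) ^ 2 + b1 * (-x) + b0) (hbt0 : bt ≠ 0)
    (hc0 : a0 * bt - b0 * atil = c0 * x) (hc1 : a1 * bt - b1 * atil = c1 * x + c0)
    (hc2 : a2 * bt - b2 * atil = c2 * x + c1) (hc3 : a3 * bt - b3 * atil = c2)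
    (hct : ct = c2 * x ^ 2 - c1 * x + c0)
    (hd0 : bt * (b0 * ct - bt * c0) = d0 * x) (hd1 : bt * (b1 * ct - bt * c1) = d1 * x + d0)
    (hd2 : bt * (b2 * ct - bt * c2) = d2 * x + d1) (hd3 : bt * (b3 * ct) = d2) :
    bezoutDet a0 a1 a2 a3 b0 b1 b2 b3 * (bt ^ 4 * ct ^ 2)
      = ct * ((c2 * d0 - c0 * d2) ^ 2 - (c1 * d0 - c0 * d1) * (c2 * d1 - c1 * d2)) := by
  have hB := bezoutDet_smul_add_smul bt (-atil) a0 a1 a2 a3 b0 b1 b2 b3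
  have hR := quadCubicResultant_smul (bt * ct) c0 c1 c2 b0 b1 b2 b3
  rw [show bt * a0 + -atil * b0 = c0 * x by linarith,
    show bt * a1 + -atil * b1 = c1 * x + c0 by linarith,
    show bt * a2 + -atil * b2 = c2 * x + c1 by linarith,
    show bt * a3 + -atil * b3 = c2 by linarith, bezoutDet_mul_linear, ← hbt] at hB
  rw [show bt * ct * b0 = d0 * x + bt ^ 2 * c0 by linarith,
    show bt * ct * b1 = d1 * x + d0 + bt ^ 2 * c1 by linarith,
    show bt * ct * b2 = d2 * x + d1 + bt ^ 2 * c2 by linarith,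
    show bt * ct * b3 = d2 by linarith, quadCubicResultant_mul_linear_add_smul, ← hct] at hR
  rw [hR]
  refine mul_left_cancel₀ hbt0 ?_
  linear_combination -(bt ^ 2 * ct ^ 2) * hB

/-- If `c` and `d` have nonnegative coefficients, then so does the cubic `b` they determine,
provided that `b` has a positive coefficient. -/
theorem cubic_coeffs_nonneg {b0 b1 b2 b3 x bt c0 c1 c2 ct d0 d1 d2 : ℝ} (hx : 0 ≤ x)
    (hbt : bt ≠ 0) (hct : 0 < ct) (hc0 : 0 ≤ c0) (hc1 : 0 ≤ c1) (hc2 : 0 ≤ c2)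
    (hd0 : 0 ≤ d0) (hd1 : 0 ≤ d1) (hd2 : 0 ≤ d2)
    (h0 : bt * (b0 * ct - bt * c0) = d0 * x) (h1 : bt * (b1 * ct - bt * c1) = d1 * x + d0)
    (h2 : bt * (b2 * ct - bt * c2) = d2 * x + d1) (h3 : bt * (b3 * ct) = d2)
    (hb : 0 < b0 ∨ 0 < b1 ∨ 0 < b2 ∨ 0 < b3) :
    0 < bt ∧ 0 ≤ b0 ∧ 0 ≤ b1 ∧ 0 ≤ b2 ∧ 0 ≤ b3 := by
  obtain ⟨k0, k1, k2, k3⟩ := mul_linear_coeff_nonneg hx hd0 hd1 hd2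
  have sq := sq_nonneg bt
  have g0 : 0 ≤ bt * b0 := nonneg_of_mul_nonneg_left (b := ct)
    (by linarith [mul_nonneg sq hc0]) hct
  have g1 : 0 ≤ bt * b1 := nonneg_of_mul_nonneg_left (b := ct)
    (by linarith [mul_nonneg sq hc1]) hct
  have g2 : 0 ≤ bt * b2 := nonneg_of_mul_nonneg_left (b := ct)
    (by linarith [mul_nonneg sq hc2]) hct
  have g3 : 0 ≤ bt * b3 := nonneg_of_mul_nonneg_left (b := ct) (by linarith) hct
  have hbt' : 0 ≤ bt := by
    rcases hb with hb | hb | hb | hb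
    · exact nonneg_of_mul_nonneg_left g0 hb
    · exact nonneg_of_mul_nonneg_left g1 hb
    · exact nonneg_of_mul_nonneg_left g2 hb
    · exact nonneg_of_mul_nonneg_left g3 hb
  have hpos := hbt'.lt_of_ne' hbt
  exact ⟨hpos, nonneg_of_mul_nonneg_right g0 hpos, nonneg_of_mul_nonneg_right g1 hpos,
    nonneg_of_mul_nonneg_right g2 hpos, nonneg_of_mul_nonneg_right g3 hpos⟩

/-- The sign conditions force all coefficients to be nonnegative, once the leading coefficient of
`d` is normalised to be positive. -/
theorem coeffs_nonneg_of_leading_coeff_pos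
    {a0 a1 a2 a3 b0 b1 b2 b3 x atil bt c0 c1 c2 ct d0 d1 d2 α1 α2 α3 l : ℝ} (hx : 0 ≤ x)
    (hbt : bt ≠ 0) (hct : 0 < ct)
    (hc0 : a0 * bt - b0 * atil = c0 * x) (hc1 : a1 * bt - b1 * atil = c1 * x + c0)
    (hc2 : a2 * bt - b2 * atil = c2 * x + c1) (hc3 : a3 * bt - b3 * atil = c2)
    (hd0 : bt * (b0 * ct - bt * c0) = d0 * x) (hd1 : bt * (b1 * ct - bt * c1) = d1 * x + d0)
    (hd2 : bt * (b2 * ct - bt * c2) = d2 * x + d1) (hd3 : bt * (b3 * ct) = d2)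
    (h1 : α1 = c1 * d0 - c0 * d1) (h2 : α2 = c2 * d0 - c0 * d2) (h3 : α3 = c2 * d1 - c1 * d2)
    (hl : l = d1 * α1 - d0 * α2) (hb : 0 < b0 ∨ 0 < b1 ∨ 0 < b2 ∨ 0 < b3)
    (hab : 0 ≤ atil * bt) (hcd : 0 ≤ c0 * d0) (hdl : 0 ≤ d2 * l) (hαd : 0 ≤ α2 * d0 * d2)
    (hd0' : d0 ≠ 0) (hp : 0 < d2) (hα1 : 0 < α1) (hdisc : 0 < α2 ^ 2 - α1 * α3) :
    (0 ≤ a0 ∧ 0 ≤ a1 ∧ 0 ≤ a2 ∧ 0 ≤ a3 ∧ 0 ≤ b0 ∧ 0 ≤ b1 ∧ 0 ≤ b2 ∧ 0 ≤ b3) ∧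
      (0 ≤ atil ∧ 0 ≤ bt ∧ 0 ≤ c0 ∧ 0 ≤ c1 ∧ 0 ≤ c2 ∧ 0 ≤ d0 ∧ 0 ≤ d1 ∧ 0 ≤ d2 ∧ 0 ≤ l) ∧
      0 ≤ α2 := by
  have hl' : 0 ≤ l := nonneg_of_mul_nonneg_right hdl hp
  obtain ⟨s3, s4, s5, s6, s7, s8⟩ := coeffs_nonneg_of_pos h1 h2 h3 hcd (hl ▸ hl')
    (nonneg_of_mul_nonneg_left hαd hp) hd0' hp hα1 hdisc
  obtain ⟨hbt', hb0, hb1, hb2, hb3⟩ := cubic_coeffs_nonneg hx hbt hct s3 s4 s5 s6.le s7 hp.le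
    hd0 hd1 hd2 hd3 hb
  have hat : 0 ≤ atil := nonneg_of_mul_nonneg_left hab hbt'
  obtain ⟨k0, k1, k2, k3⟩ := mul_linear_coeff_nonneg hx s3 s4 s5
  refine ⟨⟨?_, ?_, ?_, ?_, hb0, hb1, hb2, hb3⟩,
    ⟨hat, hbt'.le, s3, s4, s5, s6.le, s7, hp.le, hl'⟩, s8⟩
  · exact nonneg_of_mul_nonneg_left (by linarith [mul_nonneg hb0 hat]) hbt'
  · exact nonneg_of_mul_nonneg_left (by linarith [mul_nonneg hb1 hat]) hbt'
  · exact nonneg_of_mul_nonneg_left (by linarith [mul_nonneg hb2 hat]) hbt'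
  · exact nonneg_of_mul_nonneg_left (by linarith [mul_nonneg hb3 hat]) hbt'

/-- with `x ≥ 0`, condition (C1) holds iff condition (CA1) holds. -/
theorem stmt_8 (a0 a1 a2 a3 b0 b1 b2 b3 x : ℝ) (hx : 0 ≤ x)
    (a b : ℝ → ℝ)
    (ha : ∀ s, a s = a3 * s ^ 3 + a2 * s ^ 2 + a1 * s + a0)
    (hb : ∀ s, b s = b3 * s ^ 3 + b2 * s ^ 2 + b1 * s + b0)
    (atil btil : ℝ) (hatil : atil = a (-x)) (hbtil : btil = b (-x))
    (c0 c1 c2 : ℝ)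
    (hc : ∀ s, (c2 * s ^ 2 + c1 * s + c0) * (s + x) = a s * b (-x) - b s * a (-x))
    (ctil : ℝ) (hctil : ctil = c2 * x ^ 2 - c1 * x + c0)
    (d0 d1 d2 : ℝ)
    (hd : ∀ s, (d2 * s ^ 2 + d1 * s + d0) * (s + x)
        = b (-x) * (b s * ctil - b (-x) * (c2 * s ^ 2 + c1 * s + c0)))
    (alpha1 alpha2 alpha3 : ℝ)
    (halpha1 : alpha1 = c1 * d0 - c0 * d1)
    (halpha2 : alpha2 = c2 * d0 - c0 * d2)
    (halpha3 : alpha3 = c2 * d1 - c1 * d2)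
    (lambda1 : ℝ) (hlambda1 : lambda1 = d1 * alpha1 - d0 * alpha2)
    (B : Matrix (Fin 3) (Fin 3) ℝ) (hBsymm : B.IsSymm)
    (hB : ∀ z w : ℝ, z ≠ w →
        b z * a w - a z * b w
          = (z - w) * ∑ i : Fin 3, ∑ j : Fin 3, B i j * z ^ (i : ℕ) * w ^ (j : ℕ))
    (R0ab : ℝ) (hR0 : R0ab = B.det)
    :
    -- (C1)
    (((0 ≤ a0 ∧ 0 ≤ a1 ∧ 0 ≤ a2 ∧ 0 ≤ a3 ∧ 0 ≤ b0 ∧ 0 ≤ b1 ∧ 0 ≤ b2 ∧ 0 ≤ b3) ∧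
      SameSign [atil, btil, c0, c1, c2, d0, d1, d2, lambda1] ∧
      0 ≤ ctil ∧ 0 ≤ alpha2 ∧ 0 < R0ab)
    ↔
    -- (CA1)
    ((0 < b0 ∨ 0 < b1 ∨ 0 < b2 ∨ 0 < b3) ∧
      SameSign [atil, btil] ∧ btil ≠ 0 ∧
      0 ≤ c0 * d0 ∧ 0 ≤ d2 * lambda1 ∧ 0 ≤ alpha2 * d0 * d2 ∧
      d0 ≠ 0 ∧ d2 ≠ 0 ∧ 0 < ctil ∧ 0 < alpha1 ∧ 0 < R0ab)) := by
  obtain ⟨hc0, hc1, hc2, hc3⟩ := coeff_eq_of_mul_linear_eq (q0 := a0 * btil - b0 * atil)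
    (q1 := a1 * btil - b1 * atil) (q2 := a2 * btil - b2 * atil) (q3 := a3 * btil - b3 * atil)
    (fun s ↦ by rw [hc, ← hatil, ← hbtil, ha, hb]; ring)
  obtain ⟨hd0, hd1, hd2, hd3⟩ := coeff_eq_of_mul_linear_eq (q0 := btil * (b0 * ctil - btil * c0))
    (q1 := btil * (b1 * ctil - btil * c1)) (q2 := btil * (b2 * ctil - btil * c2))
    (q3 := btil * (b3 * ctil)) (fun s ↦ by rw [hd, ← hbtil, hb]; ring)
  rw [ha] at hatil
  rw [hb] at hbtil
  rw [det_eq_bezoutDet ha hb hBsymm hB] at hR0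
  have hdisc (h1 : btil ≠ 0) (h2 : 0 < ctil) (h3 : 0 < R0ab) :
      0 < alpha2 ^ 2 - alpha1 * alpha3 := by
    have h := bezoutDet_mul_eq hbtil h1 hc0 hc1 hc2 hc3 hctil hd0 hd1 hd2 hd3
    rw [← hR0, ← halpha1, ← halpha2, ← halpha3] at h
    refine pos_of_mul_pos_right (a := ctil) ?_ h2.le
    rw [← h]
    positivity
  have hneg1 : alpha1 = -c1 * -d0 - -c0 * -d1 := by linarith
  have hneg2 : alpha2 = -c2 * -d0 - -c0 * -d2 := by linarith
  have hneg3 : alpha3 = -c2 * -d1 - -c1 * -d2 := by linarith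
  have hlneg : -lambda1 = -d1 * alpha1 - -d0 * alpha2 := by linarith
  simp only [SameSign, List.forall_mem_cons, List.not_mem_nil, false_imp_iff, implies_true,
    and_true]
  constructor
  · rintro ⟨⟨ha0, ha1, ha2, ha3, hb0, hb1, hb2, hb3⟩, hs, hct, hα2, hR⟩
    have hbt : btil ≠ 0 := by
      rintro rfl
      refine hR.ne' (hR0.trans ?_)
      by_cases hat : atil = 0
      · exact bezoutDet_eq_zero_of_common_root (hatil.symm.trans hat) hbtil.symm
      · have hs' : 0 ≤ c0 * x * atil ∧ 0 ≤ (c1 * x + c0) * atil ∧ 0 ≤ (c2 * x + c1) * atil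
            ∧ 0 ≤ c2 * atil := by
          rcases hs with ⟨h1, -, h2, h3, h4, -⟩ | ⟨h1, -, h2, h3, h4, -⟩
          · obtain ⟨k0, k1, k2, k3⟩ := mul_linear_coeff_nonneg hx h2 h3 h4
            exact ⟨mul_nonneg k0 h1, mul_nonneg k1 h1, mul_nonneg k2 h1, mul_nonneg k3 h1⟩
          · obtain ⟨k0, k1, k2, k3⟩ := mul_linear_coeff_nonneg hx (neg_nonneg.2 h2)
              (neg_nonneg.2 h3) (neg_nonneg.2 h4)
            refine ⟨mul_nonneg_of_nonpos_of_nonpos ?_ h1, mul_nonneg_of_nonpos_of_nonpos ?_ h1,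
              mul_nonneg_of_nonpos_of_nonpos ?_ h1, mul_nonneg_of_nonpos_of_nonpos ?_ h1⟩ <;>
              linarith
        obtain ⟨k0, k1, k2, k3⟩ := hs'
        obtain rfl := le_antisymm (nonpos_of_mul_eq_neg hat k0 (by linarith)) hb0
        obtain rfl := le_antisymm (nonpos_of_mul_eq_neg hat k1 (by linarith)) hb1
        obtain rfl := le_antisymm (nonpos_of_mul_eq_neg hat k2 (by linarith)) hb2
        obtain rfl := le_antisymm (nonpos_of_mul_eq_neg hat k3 (by linarith)) hb3
        simp [bezoutDet]
    have hct' : 0 < ctil := by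
      refine hct.lt_of_ne' fun hz ↦ hR.ne' (hR0.trans ?_)
      have hcd : 0 ≤ c2 * d1 ∧ 0 ≤ c1 * d0 := by
        rcases hs with ⟨-, -, -, h1, h2, g0, g1, -⟩ | ⟨-, -, -, h1, h2, g0, g1, -⟩
        · exact ⟨mul_nonneg h2 g1, mul_nonneg h1 g0⟩
        · exact ⟨mul_nonneg_of_nonpos_of_nonpos h2 g1, mul_nonneg_of_nonpos_of_nonpos h1 g0⟩
      simp only [hz, mul_zero, zero_sub] at hd0 hd1 hd2 hd3
      obtain rfl := hd3
      obtain ⟨rfl, rfl⟩ := eq_zero_of_eq_neg_sq_mul hbt hcd.1 (by linarith)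
      obtain ⟨rfl, rfl⟩ := eq_zero_of_eq_neg_sq_mul hbt hcd.2 (by linarith)
      have hc0' : c0 = 0 := by simpa [hbt] using hd0
      subst hc0'
      exact bezoutDet_eq_zero_of_proportional (m := atil) hbt (by linarith) (by linarith)
        (by linarith) (by linarith)
    have hD := hdisc hbt hct' hR
    have hb : 0 < b0 ∨ 0 < b1 ∨ 0 < b2 ∨ 0 < b3 := by
      by_contra! h
      obtain ⟨h0, h1, h2, h3⟩ := h
      obtain rfl := le_antisymm h0 hb0
      obtain rfl := le_antisymm h1 hb1
      obtain rfl := le_antisymm h2 hb2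
      obtain rfl := le_antisymm h3 hb3
      exact hbt (by simp [hbtil])
    rcases hs with ⟨s1, s2, s3, s4, s5, s6, s7, s8, s9⟩ | ⟨s1, s2, s3, s4, s5, s6, s7, s8, s9⟩
    · obtain ⟨p0, p2, p⟩ := pos_of_coeffs_nonneg halpha1 halpha2 halpha3 s3 s4 s5 s6 s7 s8
        (hlambda1 ▸ s9) hα2 hD
      exact ⟨hb, .inl ⟨s1, s2⟩, hbt, by positivity, by positivity, by positivity, p0.ne', p2.ne',
        hct', p, hR⟩
    · rw [← neg_nonneg] at s3 s4 s5 s6 s7 s8 s9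
      obtain ⟨p0, p2, p⟩ := pos_of_coeffs_nonneg hneg1 hneg2 hneg3 s3 s4 s5 s6 s7 s8
        (hlneg ▸ s9) hα2 hD
      have q1 := mul_nonneg s3 s6
      have q2 := mul_nonneg s8 s9
      have q3 := mul_nonneg hα2 (mul_nonneg s6 s8)
      exact ⟨hb, .inr ⟨s1, s2⟩, hbt, by linarith, by linarith, by linarith, by linarith,
        by linarith, hct', p, hR⟩
  · rintro ⟨hb, hs, hbt, hcd, hdl, hαd, hd0', hd2', hct, hα1, hR⟩
    have hD := hdisc hbt hct hR
    have hab : 0 ≤ atil * btil := by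
      rcases hs with h | h
      · exact mul_nonneg h.1 h.2
      · exact mul_nonneg_of_nonpos_of_nonpos h.1 h.2
    rcases hd2'.lt_or_gt with hn | hp
    · obtain ⟨h1, ⟨s1, s2, s3, s4, s5, s6, s7, s8, s9⟩, h3⟩ :=
        coeffs_nonneg_of_leading_coeff_pos (a0 := a0) (a1 := a1) (a2 := a2) (a3 := a3)
          (atil := -atil) (bt := -btil) (l := -lambda1) hx (neg_ne_zero.2 hbt) hct
          (by linarith) (by linarith) (by linarith) (by linarith)
          (by linarith) (by linarith) (by linarith) (by linarith) hneg1 hneg2 hneg3 hlneg hb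
          (by linarith) (by linarith) (by linarith) (by linarith) (neg_ne_zero.2 hd0')
          (neg_pos.2 hn) hα1 hD
      rw [neg_nonneg] at s1 s2 s3 s4 s5 s6 s7 s8 s9
      exact ⟨h1, .inr ⟨s1, s2, s3, s4, s5, s6, s7, s8, s9⟩, hct.le, h3, hR⟩
    · obtain ⟨h1, h2, h3⟩ := coeffs_nonneg_of_leading_coeff_pos hx hbt hct hc0 hc1 hc2 hc3
        hd0 hd1 hd2 hd3 halpha1 halpha2 halpha3 hlambda1 hb hab hcd hdl hαd hd0' hp hα1 hD
      exact ⟨h1, .inl h2, hct.le, h3, hR⟩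
end

section
/- Suppose x >= 0. Then condition (C4) holds if and only if condition (CA4) holds. -/
/-- The determinant of the Bezoutian matrix of two cubics, in terms of their coefficients. -/
def cubicBezoutDet (a0 a1 a2 a3 b0 b1 b2 b3 : ℝ) : ℝ :=
  (!![b1 * a0 - a1 * b0, b2 * a0 - a2 * b0, b3 * a0 - a3 * b0;
      b2 * a0 - a2 * b0, b3 * a0 - a3 * b0 + (b2 * a1 - a2 * b1), b3 * a1 - a3 * b1;
      b3 * a0 - a3 * b0, b3 * a1 - a3 * b1, b3 * a2 - a3 * b2] : Matrix (Fin 3) (Fin 3) ℝ).det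

lemma det_eq_cubicBezoutDet {a0 a1 a2 a3 b0 b1 b2 b3 : ℝ} {B : Matrix (Fin 3) (Fin 3) ℝ}
    (hB : ∀ z w : ℝ, z ≠ w →
      (b3 * z ^ 3 + b2 * z ^ 2 + b1 * z + b0) * (a3 * w ^ 3 + a2 * w ^ 2 + a1 * w + a0)
        - (a3 * z ^ 3 + a2 * z ^ 2 + a1 * z + a0) * (b3 * w ^ 3 + b2 * w ^ 2 + b1 * w + b0)
        = (z - w) * ∑ i : Fin 3, ∑ j : Fin 3, B i j * z ^ (i : ℕ) * w ^ (j : ℕ)) :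
    B.det = cubicBezoutDet a0 a1 a2 a3 b0 b1 b2 b3 := by
  simp only [Fin.sum_univ_three, Fin.val_zero, Fin.val_one, Fin.val_two] at hB
  have h1 := hB 0 2 (by norm_num)
  have h2 := hB 0 3 (by norm_num)
  have h3 := hB 0 (-2) (by norm_num)
  have h4 := hB 1 2 (by norm_num)
  have h5 := hB 1 3 (by norm_num)
  have h6 := hB 1 (-2) (by norm_num)
  have h7 := hB (-1) 2 (by norm_num)
  have h8 := hB (-1) 3 (by norm_num)
  have h9 := hB (-1) (-2) (by norm_num)
  unfold cubicBezoutDet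
  congr 1
  ext i j
  fin_cases i <;> fin_cases j <;> simp <;> linarith

/-- Two cubics with a common root have a singular Bezoutian. -/
lemma cubicBezoutDet_eq_zero_of_common_root {a0 a1 a2 a3 b0 b1 b2 b3 r : ℝ}
    (ha : a3 * r ^ 3 + a2 * r ^ 2 + a1 * r + a0 = 0)
    (hb : b3 * r ^ 3 + b2 * r ^ 2 + b1 * r + b0 = 0) :
    cubicBezoutDet a0 a1 a2 a3 b0 b1 b2 b3 = 0 := by
  obtain rfl : a0 = -(a3 * r ^ 3 + a2 * r ^ 2 + a1 * r) := by linarith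
  obtain rfl : b0 = -(b3 * r ^ 3 + b2 * r ^ 2 + b1 * r) := by linarith
  simp only [cubicBezoutDet, Matrix.det_fin_three, Matrix.of_apply, Matrix.cons_val]
  ring

/-- The Bezoutian determinant depends only on the `2 × 2` minors of the coefficients. -/
lemma cubicBezoutDet_of_minors {a0 a1 a2 a3 b0 b1 b2 b3 e0 e1 e2 e3 f0 f1 f2 f3 k : ℝ}
    (h10 : k * (b1 * a0 - a1 * b0) = f1 * e0 - e1 * f0)
    (h20 : k * (b2 * a0 - a2 * b0) = f2 * e0 - e2 * f0)
    (h30 : k * (b3 * a0 - a3 * b0) = f3 * e0 - e3 * f0)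
    (h21 : k * (b2 * a1 - a2 * b1) = f2 * e1 - e2 * f1)
    (h31 : k * (b3 * a1 - a3 * b1) = f3 * e1 - e3 * f1)
    (h32 : k * (b3 * a2 - a3 * b2) = f3 * e2 - e3 * f2) :
    k ^ 3 * cubicBezoutDet a0 a1 a2 a3 b0 b1 b2 b3
      = cubicBezoutDet e0 e1 e2 e3 f0 f1 f2 f3 := by
  simp only [cubicBezoutDet, Matrix.det_fin_three, Matrix.of_apply, Matrix.cons_val]
  rw [← h10, ← h20, ← h30, ← h21, ← h31, ← h32]
  ring

/-- The Bezoutian determinant of `(s + x) c(s)` and `(s + x) d(s) + m c(s)` reduces to the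
Bezoutian determinant of the quadratics `c` and `d`. -/
lemma cubicBezoutDet_reduction (x m c0 c1 c2 d0 d1 d2 : ℝ) :
    cubicBezoutDet (x * c0) (c0 + x * c1) (c1 + x * c2) c2
      (x * d0 + m * c0) (d0 + x * d1 + m * c1) (d1 + x * d2 + m * c2) d2
      = m * (c2 * x ^ 2 - c1 * x + c0) ^ 2 *
        ((c2 * d0 - c0 * d2) ^ 2 - (c1 * d0 - c0 * d1) * (c2 * d1 - c1 * d2)) := by
  simp only [cubicBezoutDet, Matrix.det_fin_three, Matrix.of_apply, Matrix.cons_val]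
  ring

/-- with `x ≥ 0`, condition (C4) holds iff condition (CA4) holds. -/
theorem stmt_11 (a0 a1 a2 a3 b0 b1 b2 b3 x : ℝ) (hx : 0 ≤ x)
    (a b : ℝ → ℝ)
    (ha : ∀ s, a s = a3 * s ^ 3 + a2 * s ^ 2 + a1 * s + a0)
    (hb : ∀ s, b s = b3 * s ^ 3 + b2 * s ^ 2 + b1 * s + b0)
    (atil btil : ℝ) (hatil : atil = a (-x)) (hbtil : btil = b (-x))
    (c0 c1 c2 : ℝ)
    (hc : ∀ s, (c2 * s ^ 2 + c1 * s + c0) * (s + x) = a s * b (-x) - b s * a (-x))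
    (ctil : ℝ) (hctil : ctil = c2 * x ^ 2 - c1 * x + c0)
    (d0 d1 d2 : ℝ)
    (hd : ∀ s, (d2 * s ^ 2 + d1 * s + d0) * (s + x)
        = b (-x) * (b s * ctil - b (-x) * (c2 * s ^ 2 + c1 * s + c0)))
    (alpha1 alpha2 alpha3 : ℝ)
    (halpha1 : alpha1 = c1 * d0 - c0 * d1)
    (halpha2 : alpha2 = c2 * d0 - c0 * d2)
    (halpha3 : alpha3 = c2 * d1 - c1 * d2)
    (lambda2 : ℝ) (hlambda2 : lambda2 = c1 * alpha3 - c2 * alpha2)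
    (B : Matrix (Fin 3) (Fin 3) ℝ) (hBsymm : B.IsSymm)
    (hB : ∀ z w : ℝ, z ≠ w →
        b z * a w - a z * b w
          = (z - w) * ∑ i : Fin 3, ∑ j : Fin 3, B i j * z ^ (i : ℕ) * w ^ (j : ℕ))
    (R0ab : ℝ) (hR0 : R0ab = B.det)
    :
    -- (C4)
    (((0 ≤ a0 ∧ 0 ≤ a1 ∧ 0 ≤ a2 ∧ 0 ≤ a3 ∧ 0 ≤ b0 ∧ 0 ≤ b1 ∧ 0 ≤ b2 ∧ 0 ≤ b3) ∧
      SameSign [atil, btil, c0, c1, c2, d0, d1, d2, lambda2] ∧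
      0 ≤ ctil ∧ 0 ≤ alpha2 ∧ 0 < R0ab)
    ↔
    -- (CA4)
    ((0 < b0 ∨ 0 < b1 ∨ 0 < b2 ∨ 0 < b3) ∧
      SameSign [atil, btil] ∧ btil ≠ 0 ∧
      0 ≤ c2 * d2 ∧ 0 ≤ c0 * lambda2 ∧ 0 ≤ alpha2 * c0 * c2 ∧
      c0 ≠ 0 ∧ c2 ≠ 0 ∧ 0 < ctil ∧ 0 < alpha3 ∧ 0 < R0ab)) := by
  obtain rfl : a = fun s => a3 * s ^ 3 + a2 * s ^ 2 + a1 * s + a0 := funext ha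
  obtain rfl : b = fun s => b3 * s ^ 3 + b2 * s ^ 2 + b1 * s + b0 := funext hb
  rw [det_eq_cubicBezoutDet hB] at hR0
  rw [← hatil, ← hbtil] at hc
  rw [← hbtil] at hd
  beta_reduce at hatil hbtil hc hd
  clear ha hb hB hBsymm
  have hc0 := hc 0
  have hc1 := hc 1
  have hc2 := hc (-1)
  have hc3 := hc 2
  have hd0 := hd 0
  have hd1 := hd 1
  have hd2 := hd (-1)
  have hd3 := hd 2
  have e3 : c2 = btil * a3 - atil * b3 := by linarith
  have e2 : c1 + x * c2 = btil * a2 - atil * b2 := by linarith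
  have e1 : c0 + x * c1 = btil * a1 - atil * b1 := by linarith
  have e0 : x * c0 = btil * a0 - atil * b0 := by linarith
  have f3 : d2 = btil * ctil * b3 := by linarith
  have f2 : d1 + x * d2 + btil ^ 2 * c2 = btil * ctil * b2 := by linarith
  have f1 : d0 + x * d1 + btil ^ 2 * c1 = btil * ctil * b1 := by linarith
  have f0 : x * d0 + btil ^ 2 * c0 = btil * ctil * b0 := by linarith
  clear hc hd hc0 hc1 hc2 hc3 hd0 hd1 hd2 hd3
  have hR : (btil ^ 2 * ctil) ^ 3 * R0ab
      = btil ^ 2 * ctil ^ 2 * (alpha2 ^ 2 - alpha1 * alpha3) := by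
    rw [hR0, halpha1, halpha2, halpha3, hctil, ← cubicBezoutDet_reduction, ← hctil]
    apply cubicBezoutDet_of_minors <;> simp only [e0, e1, e2, f0, f1, f2] <;>
      first | ring1 | (rw [f3, e3]; ring)
  have hpos (hp : btil ≠ 0) (ht : 0 < ctil) (h : 0 < R0ab) (h2 : c2 ≠ 0) :
      0 < c0 * c2 * alpha3 ^ 2 - c2 * alpha2 * lambda2 := by
    have hQ : alpha2 ^ 2 - alpha1 * alpha3 = btil ^ 4 * ctil * R0ab := by
      have : btil ^ 2 * ctil ^ 2 ≠ 0 := by positivity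
      apply mul_left_cancel₀ this
      linear_combination -hR
    have : c0 * c2 * alpha3 ^ 2 - c2 * alpha2 * lambda2
        = c2 ^ 2 * (btil ^ 4 * ctil * R0ab) := by
      rw [← hQ, hlambda2, halpha1, halpha2, halpha3]; ring
    rw [this]
    positivity
  constructor
  · rintro ⟨⟨ha0, ha1, ha2, ha3, hb0, hb1, hb2, hb3⟩, hs, ht, hα2, hR0pos⟩
    have hs' : (0 ≤ atil * btil ∧ 0 ≤ atil * c0 ∧ 0 ≤ atil * c1 ∧ 0 ≤ atil * c2) ∧
        (0 ≤ c2 * c0 ∧ 0 ≤ c2 * c1 ∧ 0 ≤ c2 * d0 ∧ 0 ≤ c2 * d1 ∧ 0 ≤ c2 * d2 ∧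
          0 ≤ c2 * lambda2) ∧ 0 ≤ c1 * d0 ∧ 0 ≤ c1 * d2 ∧ 0 ≤ c0 * d2 ∧ 0 ≤ c0 * lambda2 ∧
          0 ≤ d2 * lambda2 := by
      simp only [SameSign, List.forall_mem_cons, List.not_mem_nil, false_implies, implies_true,
        and_true] at hs
      rcases hs with ⟨h1, h2, h3, h4, h5, h6, h7, h8, h9⟩ | ⟨h1, h2, h3, h4, h5, h6, h7, h8, h9⟩
      · refine ⟨⟨?_, ?_, ?_, ?_⟩, ⟨?_, ?_, ?_, ?_, ?_, ?_⟩, ?_, ?_, ?_, ?_, ?_⟩ <;>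
          exact mul_nonneg (by assumption) (by assumption)
      · refine ⟨⟨?_, ?_, ?_, ?_⟩, ⟨?_, ?_, ?_, ?_, ?_, ?_⟩, ?_, ?_, ?_, ?_, ?_⟩ <;>
          exact mul_nonneg_of_nonpos_of_nonpos (by assumption) (by assumption)
    have hpq : SameSign [atil, btil] := by
      simp only [SameSign, List.forall_mem_cons, List.not_mem_nil, false_implies, implies_true,
        and_true] at hs ⊢
      exact hs.imp (fun h => ⟨h.1, h.2.1⟩) (fun h => ⟨h.1, h.2.1⟩)
    clear hs
    obtain ⟨⟨-, hq0, hq1, hq2⟩, ⟨h20, h21, h2d0, h2d1, h2d2, h2l⟩, h1d0, h1d2, h0d2, h0l, hd2l⟩ :=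
      hs'
    have hb_ne : ¬ (b0 = 0 ∧ b1 = 0 ∧ b2 = 0 ∧ b3 = 0) := by
      rintro ⟨rfl, rfl, rfl, rfl⟩
      apply hR0pos.ne'
      simp [hR0, cubicBezoutDet, Matrix.det_fin_three]
    have hp : btil ≠ 0 := by
      intro hp
      rw [hp] at e0 e1 e2 e3 hbtil
      by_cases hq : atil = 0
      · apply hR0pos.ne'
        rw [hR0]
        exact cubicBezoutDet_eq_zero_of_common_root (hatil.symm.trans hq) hbtil.symm
      · have hqq : 0 < atil ^ 2 := by positivity
        have hb3' : b3 = 0 := by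
          have h : atil * c2 = -(atil ^ 2 * b3) := by rw [e3]; ring
          have : atil ^ 2 * b3 ≤ 0 := by linarith
          exact le_antisymm (nonpos_of_mul_nonpos_right this hqq) hb3
        have hc2 : c2 = 0 := by rw [e3, hb3']; ring
        have hb2' : b2 = 0 := by
          have h : atil * c1 = -(atil ^ 2 * b2) := by
            rw [hc2] at e2; linear_combination atil * e2
          have : atil ^ 2 * b2 ≤ 0 := by linarith
          exact le_antisymm (nonpos_of_mul_nonpos_right this hqq) hb2
        have hc1 : c1 = 0 := by rw [hc2, hb2'] at e2; linarith
        have hb1' : b1 = 0 := by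
          have h : atil * c0 = -(atil ^ 2 * b1) := by
            rw [hc1] at e1; linear_combination atil * e1
          have : atil ^ 2 * b1 ≤ 0 := by linarith
          exact le_antisymm (nonpos_of_mul_nonpos_right this hqq) hb1
        refine hb_ne ⟨?_, hb1', hb2', hb3'⟩
        rw [hb1', hb2', hb3'] at hbtil
        linarith
    have hpp : 0 < btil ^ 2 := by positivity
    have hc_ne : ¬ (c0 = 0 ∧ c1 = 0 ∧ c2 = 0) := by
      rintro ⟨h0, h1, h2⟩
      rw [h0] at e0 e1
      rw [h1] at e1 e2
      rw [h2] at e2 e3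
      have hker : btil ^ 3 * R0ab = 0 := by
        rw [hR0, cubicBezoutDet_of_minors (k := btil) (e0 := 0) (e1 := 0) (e2 := 0) (e3 := 0)
          (f0 := b0) (f1 := b1) (f2 := b2) (f3 := b3)]
        · simp [cubicBezoutDet, Matrix.det_fin_three]
        · linear_combination b0 * e1 - b1 * e0
        · linear_combination b0 * e2 - b2 * e0
        · linear_combination b0 * e3 - b3 * e0
        · linear_combination b1 * e2 - b2 * e1
        · linear_combination b1 * e3 - b3 * e1
        · linear_combination b2 * e3 - b3 * e2
      exact (mul_ne_zero (pow_ne_zero 3 hp) hR0pos.ne') hker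
    have ht' : 0 < ctil := by
      refine lt_of_le_of_ne ht fun h => hc_ne ?_
      rw [← h] at f3 f2 f1 f0
      have hd2 : d2 = 0 := by rw [f3]; ring
      have hc2 : c2 = 0 := by
        have h : c2 * d1 = -(btil ^ 2 * c2 ^ 2) := by
          rw [hd2] at f2; linear_combination c2 * f2
        have h' : btil ^ 2 * c2 ^ 2 ≤ 0 := by linarith
        exact pow_eq_zero_iff two_ne_zero |>.1
          (le_antisymm (nonpos_of_mul_nonpos_right h' hpp) (sq_nonneg _))
      have hd1 : d1 = 0 := by rw [hd2, hc2] at f2; linarith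
      have hc1 : c1 = 0 := by
        have h : c1 * d0 = -(btil ^ 2 * c1 ^ 2) := by
          rw [hd1] at f1; linear_combination c1 * f1
        have h' : btil ^ 2 * c1 ^ 2 ≤ 0 := by linarith
        exact pow_eq_zero_iff two_ne_zero |>.1
          (le_antisymm (nonpos_of_mul_nonpos_right h' hpp) (sq_nonneg _))
      refine ⟨?_, hc1, hc2⟩
      rw [hc1, hc2] at hctil
      linarith
    have hc2 : c2 ≠ 0 := by
      intro hc2
      rw [hc2] at halpha2 halpha3 hlambda2
      have h0 : c0 * d2 = 0 := by linarith
      have h1 : c1 * d2 = 0 := by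
        have h : d2 * lambda2 = -(c1 * d2) ^ 2 := by rw [hlambda2, halpha3]; ring
        have h' : (c1 * d2) ^ 2 ≤ 0 := by linarith
        exact pow_eq_zero_iff two_ne_zero |>.1 (le_antisymm h' (sq_nonneg _))
      have hα2' : alpha2 = 0 := by rw [halpha2]; linarith
      have hα3' : alpha3 = 0 := by rw [halpha3]; linarith
      rw [hα2', hα3'] at hR
      have : 0 < (btil ^ 2 * ctil) ^ 3 * R0ab := by positivity
      linarith
    have hmain := hpos hp ht' hR0pos hc2
    have hmul : 0 < c0 * c2 * alpha3 ^ 2 := by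
      have : 0 ≤ alpha2 * (c2 * lambda2) := mul_nonneg hα2 h2l
      linarith
    have hc0 : c0 ≠ 0 := by
      intro h; simp [h] at hmul
    have hα3 : 0 < alpha3 := by
      have hα3_ne : alpha3 ≠ 0 := by
        intro h; simp [h] at hmul
      refine lt_of_le_of_ne ?_ hα3_ne.symm
      by_contra! hneg
      have h : c2 * c1 * alpha3 = c2 * lambda2 + c2 ^ 2 * alpha2 := by rw [hlambda2]; ring
      have hc1 : c1 = 0 := by
        have h' : 0 ≤ c2 * c1 * alpha3 := by rw [h]; positivity
        have h'' : c2 * c1 ≤ 0 := by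
          by_contra! hcon
          exact absurd (mul_neg_of_pos_of_neg hcon hneg) (not_lt.2 h')
        exact (mul_eq_zero.1 (le_antisymm h'' h21)).resolve_left hc2
      rw [hc1] at halpha3
      linarith
    refine ⟨?_, hpq, hp, h2d2, h0l, ?_, hc0, hc2, ht', hα3, hR0pos⟩
    · by_contra! h
      exact hb_ne ⟨le_antisymm h.1 hb0, le_antisymm h.2.1 hb1, le_antisymm h.2.2.1 hb2,
        le_antisymm h.2.2.2 hb3⟩
    · have := mul_nonneg hα2 h20
      linarith
  · rintro ⟨hbpos, hpq, hp, h2d2, h0l, h02, hc0, hc2, ht, hα3, hR0pos⟩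
    have hpp : 0 < btil ^ 2 := by positivity
    have hcc : 0 < c2 ^ 2 := by positivity
    have hpq' : 0 ≤ btil * atil := by
      simp only [SameSign, List.forall_mem_cons, List.not_mem_nil, false_implies, implies_true,
        and_true] at hpq
      rcases hpq with h | h
      · exact mul_nonneg h.2 h.1
      · exact mul_nonneg_of_nonpos_of_nonpos h.2 h.1
    have hmain := hpos hp ht hR0pos hc2
    have h20 : 0 < c2 * c0 := by
      by_contra! hle
      have hlt : c2 * c0 < 0 := lt_of_le_of_ne hle (mul_ne_zero hc2 hc0)
      have h1 : c2 * c0 * alpha3 ^ 2 ≤ 0 := mul_nonpos_of_nonpos_of_nonneg hle (sq_nonneg _)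
      have h2 : c2 * alpha2 * lambda2 < 0 := by linarith
      have h3 : 0 ≤ (alpha2 * c0 * c2) * (c0 * lambda2) := mul_nonneg h02 h0l
      have h4 : (alpha2 * c0 * c2) * (c0 * lambda2) = c0 ^ 2 * (c2 * alpha2 * lambda2) := by ring
      have h5 : 0 < c0 ^ 2 := by positivity
      have := mul_neg_of_pos_of_neg h5 h2
      linarith
    have hα2 : 0 ≤ alpha2 := by
      refine nonneg_of_mul_nonneg_left (b := c2 * c0) ?_ h20
      linarith
    have h2l : 0 ≤ c2 * lambda2 := by
      refine nonneg_of_mul_nonneg_right (a := c0 ^ 2) ?_ (by positivity)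
      have := mul_nonneg h20.le h0l
      linarith
    have h21 : 0 ≤ c2 * c1 := by
      refine nonneg_of_mul_nonneg_left (b := alpha3) ?_ hα3
      have h : c2 * c1 * alpha3 = c2 * lambda2 + c2 ^ 2 * alpha2 := by rw [hlambda2]; ring
      rw [h]; positivity
    have h2d1 : 0 ≤ c2 * d1 := by
      refine nonneg_of_mul_nonneg_right (a := c2 ^ 2) ?_ hcc
      have h : c2 ^ 2 * (c2 * d1) = c2 ^ 2 * alpha3 + (c2 * c1) * (c2 * d2) := by
        rw [halpha3]; ring
      rw [h]; positivity
    have h2d0 : 0 ≤ c2 * d0 := by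
      refine nonneg_of_mul_nonneg_right (a := c2 ^ 2) ?_ hcc
      have h : c2 ^ 2 * (c2 * d0) = c2 ^ 2 * alpha2 + (c2 * c0) * (c2 * d2) := by
        rw [halpha2]; ring
      rw [h]; positivity
    have g3 : 0 ≤ c2 * btil * b3 := by
      refine nonneg_of_mul_nonneg_right (a := ctil) ?_ ht
      have h : ctil * (c2 * btil * b3) = c2 * d2 := by linear_combination -c2 * f3
      rw [h]; positivity
    have g2 : 0 ≤ c2 * btil * b2 := by
      refine nonneg_of_mul_nonneg_right (a := ctil) ?_ ht
      have h : ctil * (c2 * btil * b2) = c2 * d1 + x * (c2 * d2) + btil ^ 2 * c2 ^ 2 := by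
        linear_combination -c2 * f2
      rw [h]; positivity
    have g1 : 0 ≤ c2 * btil * b1 := by
      refine nonneg_of_mul_nonneg_right (a := ctil) ?_ ht
      have h : ctil * (c2 * btil * b1) = c2 * d0 + x * (c2 * d1) + btil ^ 2 * (c2 * c1) := by
        linear_combination -c2 * f1
      rw [h]; positivity
    have g0 : 0 ≤ c2 * btil * b0 := by
      refine nonneg_of_mul_nonneg_right (a := ctil) ?_ ht
      have h : ctil * (c2 * btil * b0) = x * (c2 * d0) + btil ^ 2 * (c2 * c0) := by
        linear_combination -c2 * f0
      rw [h]; positivity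
    have h2p : 0 < c2 * btil := by
      refine lt_of_le_of_ne ?_ (mul_ne_zero hc2 hp).symm
      rcases hbpos with h | h | h | h
      · exact nonneg_of_mul_nonneg_left g0 h
      · exact nonneg_of_mul_nonneg_left g1 h
      · exact nonneg_of_mul_nonneg_left g2 h
      · exact nonneg_of_mul_nonneg_left g3 h
    have hb0 : 0 ≤ b0 := nonneg_of_mul_nonneg_right g0 h2p
    have hb1 : 0 ≤ b1 := nonneg_of_mul_nonneg_right g1 h2p
    have hb2 : 0 ≤ b2 := nonneg_of_mul_nonneg_right g2 h2p
    have hb3 : 0 ≤ b3 := nonneg_of_mul_nonneg_right g3 h2p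
    have hsign {t : ℝ} (h : 0 ≤ c2 * t) : 0 ≤ btil * t := by
      refine nonneg_of_mul_nonneg_right (a := c2 ^ 2) ?_ hcc
      have := mul_nonneg h2p.le h
      linarith
    have k0 := hsign h20.le
    have k1 := hsign h21
    have k2 := h2p.le
    have kd0 := hsign h2d0
    have kd1 := hsign h2d1
    have kd2 := hsign h2d2
    have kl := hsign h2l
    rw [mul_comm] at k2
    refine ⟨⟨?_, ?_, ?_, ?_, hb0, hb1, hb2, hb3⟩, ?_, ht.le, hα2, hR0pos⟩
    · refine nonneg_of_mul_nonneg_right (a := btil ^ 2) ?_ hpp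
      have h : btil ^ 2 * a0 = x * (btil * c0) + (btil * atil) * b0 := by
        linear_combination -btil * e0
      rw [h]; positivity
    · refine nonneg_of_mul_nonneg_right (a := btil ^ 2) ?_ hpp
      have h : btil ^ 2 * a1 = btil * c0 + x * (btil * c1) + (btil * atil) * b1 := by
        linear_combination -btil * e1
      rw [h]; positivity
    · refine nonneg_of_mul_nonneg_right (a := btil ^ 2) ?_ hpp
      have h : btil ^ 2 * a2 = btil * c1 + x * (btil * c2) + (btil * atil) * b2 := by
        linear_combination -btil * e2
      rw [h]; positivity
    · refine nonneg_of_mul_nonneg_right (a := btil ^ 2) ?_ hpp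
      have h : btil ^ 2 * a3 = btil * c2 + (btil * atil) * b3 := by
        linear_combination -btil * e3
      rw [h]; positivity
    · simp only [SameSign, List.forall_mem_cons, List.not_mem_nil, false_implies, implies_true,
        and_true]
      rcases hp.lt_or_gt with hn | hn
      · right
        refine ⟨?_, hn.le, ?_, ?_, ?_, ?_, ?_, ?_, ?_⟩ <;>
          exact nonpos_of_mul_nonneg_right (by assumption) hn
      · left
        refine ⟨?_, hn.le, ?_, ?_, ?_, ?_, ?_, ?_, ?_⟩ <;>
          exact nonneg_of_mul_nonneg_right (by assumption) hn
end
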